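/- Let f(θ) := ‖D^{(r)}θ‖₁ and let θ* ∈ ℝ^n satisfy D^{(r)}θ* ≠ 0, with v* the minimum-norm element of ∂f(θ*) and v_0 the minimum-norm element of aff(∂f(θ*)). Then: (1) If r = 1, v_0 = v*; moreover, if θ* has k ≥ 1 first-order knots (jumps) with signs 𝔯_1,…,𝔯_k and the lengths of its constant pieces are n_0, n_1, …, n_k, then ‖v_0‖² = ‖v*‖² = 1/n_0 + 1/n_k + 4·Σ_{i=1}^{k−1} 1{𝔯_i ≠ 𝔯_{i+1}}/n_i. (2) If r ≥ 2, then ‖v_0‖ ≥ ((r−1)!/((r+1)·2^{r−1}))·n^{−r+1/2}. (3) If r ≥ 2 and θ* satisfies the minimum length condition with constant c, then ‖v*‖ ≤ C_r·c^{−r+1/2}·(k+1)^r·n^{−r+1/2} for a constant C_r depending only on r, where k := k_r(θ*). -/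

import Mathlib

open MeasureTheory ProbabilityTheory
open scoped BigOperators

noncomputable section

/-- Zero-padding of a finite vector to a sequence on `ℕ`. -/
def pad {n : ℕ} (θ : Fin n → ℝ) : ℕ → ℝ := fun t => if h : t < n then θ ⟨t, h⟩ else 0

/-- First-order forward difference of a sequence. -/
def dseq (f : ℕ → ℝ) : ℕ → ℝ := fun t => f (t + 1) - f t

/-- `DD r θ t` is the `t`-th entry (0-indexed) of the `r`-th order difference `D^{(r)} θ`
of the vector `θ ∈ ℝ^n`; only the entries `t < n - r` are meaningful. -/
def DD (r : ℕ) {n : ℕ} (θ : Fin n → ℝ) : ℕ → ℝ := dseq^[r] (pad θ)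

/-- The ℓ¹ norm `‖D^{(r)} θ‖₁`. -/
def Dl1 (r : ℕ) {n : ℕ} (θ : Fin n → ℝ) : ℝ := ∑ t ∈ Finset.range (n - r), |DD r θ t|

/-- The number of nonzero entries `‖D^{(r)} θ‖₀`. -/
def Dl0 (r : ℕ) {n : ℕ} (θ : Fin n → ℝ) : ℕ :=
  ((Finset.range (n - r)).filter fun t => DD r θ t ≠ 0).card

/-- Squared Euclidean norm. -/
def sqnorm {n : ℕ} (x : Fin n → ℝ) : ℝ := ∑ i, x i ^ 2

/-- Euclidean norm. -/
def eunorm {n : ℕ} (x : Fin n → ℝ) : ℝ := Real.sqrt (sqnorm x)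

/-- `V^{(r)}(θ) = n^{r-1} ‖D^{(r)} θ‖₁`. -/
def Vr (r : ℕ) {n : ℕ} (θ : Fin n → ℝ) : ℝ := (n : ℝ) ^ ((r : ℤ) - 1) * Dl1 r θ

/-- The constraint set `K^{(r)}(V) = {θ : ‖D^{(r)} θ‖₁ ≤ V n^{1-r}}`. -/
def Kset (r n : ℕ) (V : ℝ) : Set (Fin n → ℝ) := {θ | Dl1 r θ ≤ V * (n : ℝ) ^ (1 - (r : ℤ))}

/-- `est` is a least-squares projection onto the set `K`. -/
def IsProjOn {n : ℕ} (est : (Fin n → ℝ) → Fin n → ℝ) (K : Set (Fin n → ℝ)) : Prop :=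
  ∀ y, est y ∈ K ∧ ∀ θ ∈ K, sqnorm (y - est y) ≤ sqnorm (y - θ)

/-- `est` is the penalized trend filtering estimator of order `r` with noise level `σ`
and tuning parameter `lam`: it minimizes `½‖y - θ‖² + σ n^{r-1} lam ‖D^{(r)} θ‖₁`. -/
def IsPenEst (r : ℕ) {n : ℕ} (σ lam : ℝ) (est : (Fin n → ℝ) → Fin n → ℝ) : Prop :=
  ∀ y θ, 1 / 2 * sqnorm (y - est y) + σ * (n : ℝ) ^ ((r : ℤ) - 1) * lam * Dl1 r (est y) ≤
    1 / 2 * sqnorm (y - θ) + σ * (n : ℝ) ^ ((r : ℤ) - 1) * lam * Dl1 r θ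

/-- The Gaussian measure `N_n(0, σ² I_n)` on `ℝ^n`. -/
def gaussVec (n : ℕ) (σ : ℝ) : Measure (Fin n → ℝ) :=
  Measure.pi fun _ => gaussianReal 0 (σ ^ 2).toNNReal

/-- The risk `R(θ̂, θ*) = (1/n) E ‖θ̂(θ* + ξ) - θ*‖²` for `ξ ∼ N_n(0, σ² I_n)`. -/
def risk {n : ℕ} (σ : ℝ) (est : (Fin n → ℝ) → Fin n → ℝ) (θs : Fin n → ℝ) : ℝ :=
  1 / (n : ℝ) * ∫ ξ, sqnorm (est (θs + ξ) - θs) ∂gaussVec n σ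

/-- `j` (with signs `sg`) enumerates, in increasing order and paper (1-indexed) convention,
exactly the `r`-th order knots of `θ ∈ ℝ^n`; an index `2 ≤ m ≤ n - r + 1` is a knot when
`(D^{(r-1)}θ)_{m-1} ≠ (D^{(r-1)}θ)_m` (1-indexed entries), and its sign is `+1` when
`(D^{(r-1)}θ)_{m-1} < (D^{(r-1)}θ)_m` and `-1` otherwise. -/
def IsKnotSeq (r n : ℕ) (θ : Fin n → ℝ) (k : ℕ) (j : Fin k → ℕ) (sg : Fin k → ℝ) : Prop :=
  StrictMono j ∧ (∀ i, 2 ≤ j i ∧ j i ≤ n - r + 1) ∧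
    (∀ m : ℕ, 2 ≤ m → m ≤ n - r + 1 →
      (DD (r - 1) θ (m - 2) ≠ DD (r - 1) θ (m - 1) ↔ ∃ i, j i = m)) ∧
    ∀ i, sg i = if DD (r - 1) θ (j i - 2) < DD (r - 1) θ (j i - 1) then 1 else -1

/-- Extended knot sequence: `jext 0 = j_0 = 1`, `jext i = j_i` for `1 ≤ i ≤ k`, and
`jext (k+1) = j_{k+1} = n - r + 2`. -/
def jext (n r k : ℕ) (j : Fin k → ℕ) : ℕ → ℕ := fun i =>
  if i = 0 then 1 else if h : i - 1 < k then j ⟨i - 1, h⟩ else n - r + 2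

/-- Extended sign sequence: `sgext i = 𝔯_i` for `1 ≤ i ≤ k` and `0` otherwise. -/
def sgext (k : ℕ) (sg : Fin k → ℝ) : ℕ → ℝ := fun i =>
  if h : 0 < i ∧ i - 1 < k then sg ⟨i - 1, h.2⟩ else 0

/-- The lengths `n_0 = j_1 + r - 2`, `n_i = j_{i+1} - j_i` (`1 ≤ i ≤ k-1`),
`n_k = n - r + 2 - j_k`. -/
def nlen (n r k : ℕ) (j : Fin k → ℕ) : ℕ → ℕ := fun i =>
  if i = 0 then jext n r k j 1 + r - 2 else jext n r k j (i + 1) - jext n r k j i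

/-- `n_{i*} = min(n_i, n/(k+1))`. -/
def nstar (n r k : ℕ) (j : Fin k → ℕ) (i : ℕ) : ℝ :=
  min (nlen n r k j i : ℝ) ((n : ℝ) / ((k : ℝ) + 1))

/-- `δ_r(θ)²` defined from the knot data of `θ`. -/
def deltaSq (n r k : ℕ) (j : Fin k → ℕ) (sg : Fin k → ℝ) : ℝ :=
  nstar n r k j 0 ^ (1 - 2 * (r : ℤ)) + nstar n r k j k ^ (1 - 2 * (r : ℤ)) +
    ∑ i ∈ Finset.Ico 1 k,
      if sgext k sg i ≠ sgext k sg (i + 1) then nstar n r k j i ^ (1 - 2 * (r : ℤ)) else 0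

/-- `Δ_r(θ)` defined from the knot data of `θ`. -/
def DeltaR (n r k : ℕ) (j : Fin k → ℕ) (sg : Fin k → ℝ) : ℝ :=
  ((k : ℝ) + 1) / (n : ℝ) * Real.log (Real.exp 1 * (n : ℝ) / ((k : ℝ) + 1)) +
    deltaSq n r k j sg / (n : ℝ) * ((n : ℝ) / ((k : ℝ) + 1)) ^ (2 * (r : ℤ) - 1) *
      Real.log (Real.exp 1 * (n : ℝ) / ((k : ℝ) + 1)) +
    (Real.sqrt (deltaSq n r k j sg) / Real.sqrt (n : ℝ)) ^ ((1 : ℝ) / (r : ℝ))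

/-- The minimum length condition with constant `c`: `n_i ≥ c n/(k+1)` for every `0 ≤ i ≤ k`
with `𝔯_i ≠ 𝔯_{i+1}` (where `𝔯_0 = 𝔯_{k+1} = 0`). -/
def MinLen (n r k : ℕ) (j : Fin k → ℕ) (sg : Fin k → ℝ) (c : ℝ) : Prop :=
  ∀ i ≤ k, sgext k sg i ≠ sgext k sg (i + 1) →
    c * (n : ℝ) / ((k : ℝ) + 1) ≤ (nlen n r k j i : ℝ)

/-- The subdifferential of `g` at `θ`. -/
def subdiff {n : ℕ} (g : (Fin n → ℝ) → ℝ) (θ : Fin n → ℝ) : Set (Fin n → ℝ) :=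
  {v | ∀ y, g θ + ∑ i, v i * (y i - θ i) ≤ g y}

/-- `v` is the minimum-norm element of `S`. -/
def IsMinNormIn {n : ℕ} (v : Fin n → ℝ) (S : Set (Fin n → ℝ)) : Prop :=
  v ∈ S ∧ ∀ w ∈ S, eunorm v ≤ eunorm w

/-- `c • S`. -/
def scaleSet {n : ℕ} (c : ℝ) (S : Set (Fin n → ℝ)) : Set (Fin n → ℝ) := (c • ·) '' S

/-- The cone generated by `S`: `⋃_{c ≥ 0} c • S`. -/
def coneOf {n : ℕ} (S : Set (Fin n → ℝ)) : Set (Fin n → ℝ) := ⋃ c ∈ Set.Ici (0 : ℝ), scaleSet c S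

/-- Euclidean distance from a point to a set. -/
def distSet {n : ℕ} (z : Fin n → ℝ) (S : Set (Fin n → ℝ)) : ℝ :=
  sInf ((fun v => eunorm (z - v)) '' S)

/-- Gaussian mean squared distance `D(S) = E dist²(Z, S)`, `Z ∼ N_n(0, I_n)`. -/
def gaussMSD {n : ℕ} (S : Set (Fin n → ℝ)) : ℝ := ∫ z, distSet z S ^ 2 ∂gaussVec n 1

/-- `lam z` is, for each `z`, the minimizer over `λ ≥ 0` of `dist(z, λ S)`. -/
def IsLamFun {n : ℕ} (S : Set (Fin n → ℝ)) (lam : (Fin n → ℝ) → ℝ) : Prop :=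
  ∀ z, 0 ≤ lam z ∧ ∀ μ : ℝ, 0 ≤ μ → distSet z (scaleSet (lam z) S) ≤ distSet z (scaleSet μ S)

/-- Euclidean covering number of `K` at scale `ε`. -/
def covN {n : ℕ} (ε : ℝ) (K : Set (Fin n → ℝ)) : ℕ :=
  sInf {m : ℕ | ∃ a : Fin m → Fin n → ℝ, ∀ x ∈ K, ∃ i, eunorm (x - a i) ≤ ε}

/-- `K` `t`-shatters the (finite) index set `A`. -/
def fatShatters {n : ℕ} (K : Set (Fin n → ℝ)) (t : ℝ) (A : Finset (Fin n)) : Prop :=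
  ∃ h : Fin n → ℝ, ∀ S : Finset (Fin n), S ⊆ A →
    ∃ θ ∈ K, (∀ i ∈ S, θ i ≤ h i) ∧ ∀ i ∈ A, i ∉ S → h i + t ≤ θ i

/-- The fat shattering dimension `v(K, t)`. -/
def fatDim {n : ℕ} (K : Set (Fin n → ℝ)) (t : ℝ) : ℕ :=
  sSup {m : ℕ | ∃ A : Finset (Fin n), A.card = m ∧ fatShatters K t A}

/-- The tangent cone of `K` at `θ`. -/
def tanCone {n : ℕ} (K : Set (Fin n → ℝ)) (θ : Fin n → ℝ) : Set (Fin n → ℝ) :=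
  closure {w | ∃ t : ℝ, 0 ≤ t ∧ ∃ η ∈ K, w = t • (η - θ)}

/-- `V_{a,b}(f) = Σ_{m=a+1}^{b} |f_m - f_{m-1}|` for the (paper 1-indexed) sequence whose
`m`-th entry is `f (m-1)`. -/
def Vab (f : ℕ → ℝ) (a b : ℕ) : ℝ := ∑ t ∈ Finset.Ico (a - 1) (b - 1), |f (t + 1) - f t|

/-- `Acoef r n v j = Σ_{i=j}^n C(r+i-j-1, r-1) v_i` (paper 1-indexed). -/
def Acoef (r n : ℕ) (v : Fin n → ℝ) (jj : ℕ) : ℝ :=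
  ∑ i : Fin n, (if jj ≤ i.1 + 1 then ((r + (i.1 + 1) - jj - 1).choose (r - 1) : ℝ) else 0) * v i

/-- The class `C_r({a_i}, {s_i})`. -/
def Cras (r n : ℕ) (a s : ℕ → ℝ) : Set (Fin n → ℝ) :=
  {θ | (∀ i < r - 1, a i ≤ DD i θ 0 ∧ DD i θ 0 ≤ a i + s i) ∧
    a (r - 1) ≤ DD (r - 1) θ 0 ∧
    (∀ t : ℕ, t + 1 ≤ n - r → DD (r - 1) θ t ≤ DD (r - 1) θ (t + 1)) ∧
    DD (r - 1) θ (n - r) ≤ a (r - 1) + s (r - 1)}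

/-- The class `C_r(a, V) = {θ : a ≤ (D^{(r-1)}θ)_1 ≤ ⋯ ≤ (D^{(r-1)}θ)_{n-r+1} ≤ a + V}`. -/
def CrMono (r n : ℕ) (a V : ℝ) : Set (Fin n → ℝ) :=
  {θ | a ≤ DD (r - 1) θ 0 ∧
    (∀ t : ℕ, t + 1 ≤ n - r → DD (r - 1) θ t ≤ DD (r - 1) θ (t + 1)) ∧
    DD (r - 1) θ (n - r) ≤ a + V}


/-! ### Basic facts on differences -/

lemma dseq_iter_congr (r : ℕ) : ∀ (f g : ℕ → ℝ) (t : ℕ),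
    (∀ s, t ≤ s → s ≤ t + r → f s = g s) → dseq^[r] f t = dseq^[r] g t := by
  induction r with
  | zero => intro f g t h; exact h t le_rfl le_rfl
  | succ r ih =>
    intro f g t h
    rw [Function.iterate_succ_apply, Function.iterate_succ_apply]
    apply ih
    intro s h1 h2
    simp only [dseq]
    rw [h s h1 (by omega), h (s + 1) (by omega) (by omega)]

lemma dseq_iter_lin (r : ℕ) : ∀ (f g : ℕ → ℝ) (c : ℝ) (t : ℕ),
    dseq^[r] (fun s => f s + c * g s) t = dseq^[r] f t + c * dseq^[r] g t := by
  induction r with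
  | zero => intro f g c t; rfl
  | succ r ih =>
    intro f g c t
    rw [Function.iterate_succ_apply, Function.iterate_succ_apply, Function.iterate_succ_apply,
      ← ih]
    apply dseq_iter_congr
    intro s _ _
    simp only [dseq]; ring

lemma DD_lin (r : ℕ) {n : ℕ} (θ x : Fin n → ℝ) (c : ℝ) (t : ℕ) :
    DD r (fun i => θ i + c * x i) t = DD r θ t + c * DD r x t := by
  unfold DD
  rw [← dseq_iter_lin]
  apply dseq_iter_congr
  intro s _ _
  unfold pad
  split_ifs <;> simp

lemma DD_succ (r : ℕ) {n : ℕ} (θ : Fin n → ℝ) (t : ℕ) :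
    DD (r + 1) θ t = DD r θ (t + 1) - DD r θ t := by
  unfold DD
  rw [Function.iterate_succ_apply']
  rfl

lemma DD_restrict (r : ℕ) {n : ℕ} (f : ℕ → ℝ) (t : ℕ) (ht : t + r < n) :
    DD r (fun i : Fin n => f i) t = dseq^[r] f t := by
  unfold DD
  apply dseq_iter_congr
  intro s _ h2
  have : s < n := by omega
  simp [pad, this]

lemma sum_pad {n : ℕ} (v : ℕ → ℝ) (y : Fin n → ℝ) :
    ∑ i : Fin n, v i * y i = ∑ i ∈ Finset.range n, v i * pad y i := by
  rw [← Fin.sum_univ_eq_sum_range (fun i => v i * pad y i)]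
  apply Finset.sum_congr rfl
  intro i _
  simp [pad]

/-! ### Subdifferential -/

lemma mem_subdiff_of (r : ℕ) {n : ℕ} (θ v : Fin n → ℝ) (w : ℕ → ℝ)
    (h1 : ∀ t < n - r, |w t| ≤ 1) (h2 : ∀ t < n - r, w t * DD r θ t = |DD r θ t|)
    (h3 : ∀ y : Fin n → ℝ, ∑ i, v i * y i = ∑ t ∈ Finset.range (n - r), w t * DD r y t) :
    v ∈ subdiff (fun α => Dl1 r α) θ := by
  intro y
  have e1 : ∑ i, v i * (y i - θ i) = ∑ i, v i * y i - ∑ i, v i * θ i := by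
    rw [← Finset.sum_sub_distrib]
    exact Finset.sum_congr rfl fun i _ => by ring
  have e2 : Dl1 r θ = ∑ t ∈ Finset.range (n - r), w t * DD r θ t :=
    Finset.sum_congr rfl fun t ht => (h2 t (Finset.mem_range.1 ht)).symm
  have e3 : ∑ t ∈ Finset.range (n - r), w t * DD r y t ≤ Dl1 r y := by
    apply Finset.sum_le_sum
    intro t ht
    calc w t * DD r y t ≤ |w t * DD r y t| := le_abs_self _
      _ = |w t| * |DD r y t| := abs_mul _ _
      _ ≤ 1 * |DD r y t| := by
        gcongr
        exact h1 t (Finset.mem_range.1 ht)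
      _ = _ := one_mul _
  show Dl1 r θ + _ ≤ Dl1 r y
  rw [e1, h3, h3, e2]
  linarith

lemma exists_small (s : Finset ℕ) (a b : ℕ → ℝ) :
    ∃ ε : ℝ, 0 < ε ∧ ∀ t ∈ s, a t ≠ 0 → ε * |b t| ≤ |a t| := by
  classical
  induction s using Finset.induction_on with
  | empty => exact ⟨1, one_pos, by simp⟩
  | insert x s hx ih =>
    obtain ⟨ε, hε, h⟩ := ih
    by_cases ha : a x = 0
    · refine ⟨ε, hε, ?_⟩
      intro t ht hat
      rcases Finset.mem_insert.1 ht with rfl | ht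
      · exact absurd ha hat
      · exact h t ht hat
    · have hax : 0 < |a x| := abs_pos.2 ha
      have hb : 0 < |b x| + 1 := by positivity
      refine ⟨min ε (|a x| / (|b x| + 1)), lt_min hε (by positivity), ?_⟩
      intro t ht hat
      rcases Finset.mem_insert.1 ht with rfl | ht
      · calc min ε (|a t| / (|b t| + 1)) * |b t| ≤ (|a t| / (|b t| + 1)) * |b t| := by
              gcongr; exact min_le_right _ _
          _ ≤ (|a t| / (|b t| + 1)) * (|b t| + 1) := by gcongr; linarith
          _ = |a t| := by field_simp
      · refine le_trans ?_ (h t ht hat)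
        gcongr
        exact min_le_left _ _

lemma abs_add_small (a b : ℝ) (ha : a ≠ 0) (h : |b| ≤ |a|) :
    |a + b| = |a| + Real.sign a * b := by
  rcases lt_or_gt_of_ne ha with h0 | h0
  · rw [Real.sign_of_neg h0]
    rw [abs_of_neg h0] at h ⊢
    have := abs_le.1 h
    rw [abs_of_nonpos (by linarith)]; ring
  · rw [Real.sign_of_pos h0]
    rw [abs_of_pos h0] at h ⊢
    have := abs_le.1 h
    rw [abs_of_nonneg (by linarith)]; ring

lemma subdiff_pair (r : ℕ) {n : ℕ} (θ v x : Fin n → ℝ)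
    (hv : v ∈ subdiff (fun α => Dl1 r α) θ)
    (hx : ∀ t < n - r, DD r θ t = 0 → DD r x t = 0) :
    ∑ i, v i * x i = ∑ t ∈ Finset.range (n - r), Real.sign (DD r θ t) * DD r x t := by
  obtain ⟨ε, hε, h⟩ := exists_small (Finset.range (n - r)) (DD r θ) (DD r x)
  have key : ∀ δ : ℝ, |δ| = ε → δ * ∑ i, v i * x i ≤
      δ * ∑ t ∈ Finset.range (n - r), Real.sign (DD r θ t) * DD r x t := by
    intro δ hδ
    have h1 := hv (fun i => θ i + δ * x i)
    have e1 : ∑ i, v i * ((fun i => θ i + δ * x i) i - θ i) = δ * ∑ i, v i * x i := by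
      rw [Finset.mul_sum]
      exact Finset.sum_congr rfl fun i _ => by ring
    have e2 : Dl1 r (fun i => θ i + δ * x i) = Dl1 r θ +
        δ * ∑ t ∈ Finset.range (n - r), Real.sign (DD r θ t) * DD r x t := by
      unfold Dl1
      rw [Finset.mul_sum, ← Finset.sum_add_distrib]
      apply Finset.sum_congr rfl
      intro t ht
      rw [DD_lin]
      by_cases h0 : DD r θ t = 0
      · rw [h0, hx t (Finset.mem_range.1 ht) h0]; simp
      · rw [abs_add_small _ _ h0]
        · ring
        · rw [abs_mul, hδ]; exact h t ht h0
    simp only at h1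
    rw [e2] at h1
    have e1' : ∑ i, v i * (θ i + δ * x i - θ i) = δ * ∑ i, v i * x i := e1
    rw [e1'] at h1
    linarith
  have k1 := key ε (abs_of_pos hε)
  have k2 := key (-ε) (by rw [abs_neg, abs_of_pos hε])
  apply le_antisymm
  · exact le_of_mul_le_mul_left k1 hε
  · apply le_of_mul_le_mul_left _ hε
    linarith

lemma aff_pair (r : ℕ) {n : ℕ} (θ v x : Fin n → ℝ)
    (hv : v ∈ (affineSpan ℝ (subdiff (fun α => Dl1 r α) θ) : Set (Fin n → ℝ)))
    (hx : ∀ t < n - r, DD r θ t = 0 → DD r x t = 0) :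
    ∑ i, v i * x i = ∑ t ∈ Finset.range (n - r), Real.sign (DD r θ t) * DD r x t := by
  have hv' : v ∈ affineSpan ℝ (subdiff (fun α => Dl1 r α) θ) := hv
  refine affineSpan_induction (p := fun v => ∑ i, v i * x i =
    ∑ t ∈ Finset.range (n - r), Real.sign (DD r θ t) * DD r x t) hv'
    (fun y hy => subdiff_pair r θ y x hy hx) ?_
  intro c u v w hu hv hw
  have : ∑ i, (c • (u -ᵥ v) +ᵥ w) i * x i =
      c * (∑ i, u i * x i - ∑ i, v i * x i) + ∑ i, w i * x i := by
    rw [← Finset.sum_sub_distrib, Finset.mul_sum, ← Finset.sum_add_distrib]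
    apply Finset.sum_congr rfl
    intro i _
    simp only [vsub_eq_sub, vadd_eq_add, Pi.add_apply, Pi.smul_apply, Pi.sub_apply, smul_eq_mul]
    ring
  rw [this, hu, hv, hw]
  ring

lemma rpow_half_sq (x : ℝ) (hx : 0 < x) (r : ℕ) (hr : 1 ≤ r) :
    (x ^ (-(r : ℝ) + 1 / 2)) ^ 2 = (x ^ (2 * r - 1))⁻¹ := by
  rw [← Real.rpow_natCast, ← Real.rpow_natCast, ← Real.rpow_mul hx.le, ← Real.rpow_neg hx.le]
  congr 1
  rw [Nat.cast_sub (by omega)]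
  push_cast
  ring

lemma eunorm_nonneg {n : ℕ} (x : Fin n → ℝ) : 0 ≤ eunorm x := Real.sqrt_nonneg _

lemma sqnorm_nonneg {n : ℕ} (x : Fin n → ℝ) : 0 ≤ sqnorm x :=
  Finset.sum_nonneg fun _ _ => sq_nonneg _

lemma sqnorm_le_of {n : ℕ} {x y : Fin n → ℝ} (h : eunorm x ≤ eunorm y) :
    sqnorm x ≤ sqnorm y := (Real.sqrt_le_sqrt_iff (sqnorm_nonneg y)).1 h

/-! ### The lower bound -/

/-- truncated power sequence -/
def tpow (t : ℕ) (r : ℕ) : ℕ → ℝ := fun i =>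
  if r = 0 then (if i = t then 1 else 0) else
    if i ≤ t then 0 else ((i - t - 1).choose (r - 1) : ℝ)

lemma dseq_tpow (t r : ℕ) : dseq (tpow t (r + 1)) = tpow t r := by
  funext i
  rcases r with _ | r
  · simp only [dseq, tpow]
    rcases lt_trichotomy i t with h | h | h
    · simp [h.le, h.ne, Nat.succ_le_of_lt h]
    · simp [h]
    · have h1 : ¬ i ≤ t := by omega
      have h2 : ¬ i + 1 ≤ t := by omega
      simp [h1, h2, h.ne']
  · simp only [dseq, tpow]
    rcases lt_trichotomy i t with h | h | h
    · simp [h.le, Nat.succ_le_of_lt h]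
    · simp [h]
    · have h1 : ¬ i ≤ t := by omega
      have h2 : ¬ i + 1 ≤ t := by omega
      have h3 : i + 1 - t - 1 = (i - t - 1) + 1 := by omega
      simp only [h1, h2, h3, if_false, Nat.add_eq_zero_iff, one_ne_zero, and_false,
        Nat.add_sub_cancel, Nat.choose_succ_succ]
      push_cast
      ring

lemma dseq_iter_tpow (t r : ℕ) : dseq^[r] (tpow t r) = tpow t 0 := by
  induction r with
  | zero => rfl
  | succ r ih => rw [Function.iterate_succ_apply, dseq_tpow, ih]

lemma lower_bound (r : ℕ) (hr : 2 ≤ r) (n : ℕ) (hn : r + 1 ≤ n) (θ : Fin n → ℝ)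
    (hθ : ∃ t < n - r, DD r θ t ≠ 0) (v : Fin n → ℝ)
    (hv : v ∈ (affineSpan ℝ (subdiff (fun α => Dl1 r α) θ) : Set (Fin n → ℝ))) :
    (Nat.factorial (r - 1) : ℝ) / (((r : ℝ) + 1) * 2 ^ (r - 1)) *
      (n : ℝ) ^ (-(r : ℝ) + 1 / 2) ≤ eunorm v := by
  obtain ⟨t, ht, hne⟩ := hθ
  have hD : ∀ s < n - r, DD r (fun i : Fin n => tpow t r i) s = if s = t then 1 else 0 := by
    intro s hs
    rw [DD_restrict r _ s (by omega), dseq_iter_tpow]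
    simp [tpow]
  have hp := aff_pair r θ v (fun i : Fin n => tpow t r i) hv (by
    intro s hs h0
    rw [hD s hs, if_neg]
    rintro rfl
    exact hne h0)
  have hp2 : ∑ i : Fin n, v i * tpow t r i = Real.sign (DD r θ t) := by
    rw [hp, Finset.sum_eq_single t]
    · rw [hD t ht]; simp
    · intro s hs hst
      rw [hD s (Finset.mem_range.1 hs), if_neg hst, mul_zero]
    · intro h; exact absurd (Finset.mem_range.2 ht) h
  have hs1 : Real.sign (DD r θ t) ^ 2 = 1 := by
    rcases Real.sign_apply_eq_of_ne_zero _ hne with h | h <;> rw [h] <;> norm_num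
  have hn0 : (0 : ℝ) < n := by
    have : 0 < n := by omega
    exact_mod_cast this
  have hf0 : (0 : ℝ) < (Nat.factorial (r - 1) : ℝ) := by exact_mod_cast Nat.factorial_pos _
  have hb : ∀ i : Fin n, (tpow t r i) ^ 2 ≤ ((n : ℝ) ^ (r - 1) / (Nat.factorial (r - 1) : ℝ)) ^ 2 := by
    intro i
    have hr0 : r ≠ 0 := by omega
    simp only [tpow, hr0, if_false]
    split_ifs
    · rw [zero_pow two_ne_zero]; positivity
    · gcongr
      refine le_trans (Nat.choose_le_pow_div (α := ℝ) (r - 1) (i - t - 1)) ?_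
      gcongr
      omega
  have hx : ∑ i : Fin n, (tpow t r i) ^ 2 ≤
      n * ((n : ℝ) ^ (r - 1) / (Nat.factorial (r - 1) : ℝ)) ^ 2 := by
    refine le_trans (Finset.sum_le_sum fun i _ => hb i) ?_
    simp
  have hcs := Finset.sum_mul_sq_le_sq_mul_sq Finset.univ v (fun i : Fin n => tpow t r i)
  rw [hp2, hs1] at hcs
  have hv1 : 1 ≤ sqnorm v * (n * ((n : ℝ) ^ (r - 1) / (Nat.factorial (r - 1) : ℝ)) ^ 2) := by
    refine le_trans hcs ?_
    unfold sqnorm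
    gcongr
  apply Real.le_sqrt_of_sq_le
  have hpw : ((n : ℝ) ^ (-(r : ℝ) + 1 / 2)) ^ 2 = ((n : ℝ) ^ (2 * r - 1))⁻¹ := by
    exact rpow_half_sq n hn0 r (by omega)
  have hp3 : (n : ℝ) ^ (2 * r - 1) = n * ((n : ℝ) ^ (r - 1)) ^ 2 := by
    rw [← pow_mul, ← pow_succ']
    congr 1; omega
  have hcoef : (Nat.factorial (r - 1) : ℝ) / (((r : ℝ) + 1) * 2 ^ (r - 1)) ≤
      (Nat.factorial (r - 1) : ℝ) := by
    apply div_le_self hf0.le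
    have : (1 : ℝ) ≤ 2 ^ (r - 1) := one_le_pow₀ (by norm_num)
    have h2 : (0 : ℝ) ≤ r := by positivity
    nlinarith
  rw [mul_pow, hpw]
  calc _ ≤ (Nat.factorial (r - 1) : ℝ) ^ 2 * ((n : ℝ) ^ (2 * r - 1))⁻¹ := by gcongr
    _ ≤ sqnorm v := by
      rw [← div_eq_mul_inv, div_le_iff₀ (by positivity), hp3]
      have : sqnorm v * (n * ((n : ℝ) ^ (r - 1) / (Nat.factorial (r - 1) : ℝ)) ^ 2) =
        sqnorm v * (n * ((n : ℝ) ^ (r - 1)) ^ 2) / (Nat.factorial (r - 1) : ℝ) ^ 2 := by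
        rw [div_pow]; ring
      rw [this, le_div_iff₀ (by positivity)] at hv1
      linarith

/-! ### Knots -/

lemma jext_zero (n r k : ℕ) (j : Fin k → ℕ) : jext n r k j 0 = 1 := rfl

lemma jext_last (n r k : ℕ) (j : Fin k → ℕ) (q : ℕ) (hq : k + 1 ≤ q) :
    jext n r k j q = n - r + 2 := by
  have h1 : q ≠ 0 := by omega
  have h2 : ¬ (q - 1 < k) := by omega
  simp [jext, h1, h2]

lemma jext_succ (n r k : ℕ) (j : Fin k → ℕ) (i : Fin k) :
    jext n r k j (i + 1) = j i := by
  simp [jext]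

lemma sgext_zero (k : ℕ) (sg : Fin k → ℝ) : sgext k sg 0 = 0 := by simp [sgext]

lemma sgext_last (k : ℕ) (sg : Fin k → ℝ) (q : ℕ) (hq : k + 1 ≤ q) : sgext k sg q = 0 := by
  have h2 : ¬ (q - 1 < k) := by omega
  simp [sgext, h2]

lemma sgext_succ (k : ℕ) (sg : Fin k → ℝ) (i : Fin k) : sgext k sg (i + 1) = sg i := by
  simp [sgext]

lemma jext_strict (r n : ℕ) (θ : Fin n → ℝ) (k : ℕ) (j : Fin k → ℕ) (sg : Fin k → ℝ)
    (h : IsKnotSeq r n θ k j sg) (q : ℕ) (hq : q ≤ k) :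
    jext n r k j q < jext n r k j (q + 1) := by
  obtain ⟨hm, hb, -, -⟩ := h
  rcases Nat.lt_or_ge q k with hqk | hqk
  · rw [jext_succ n r k j ⟨q, hqk⟩]
    rcases q with _ | q
    · rw [jext_zero]; have := (hb ⟨0, hqk⟩).1; omega
    · rw [jext_succ n r k j ⟨q, by omega⟩]
      apply hm
      simp [Fin.lt_def]
  · rw [jext_last n r k j (q + 1) (by omega)]
    rcases q with _ | q
    · rw [jext_zero]; omega
    · rw [jext_succ n r k j ⟨q, by omega⟩]
      have := (hb ⟨q, by omega⟩).2
      omega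

lemma sign_knot (r n : ℕ) (hr : 1 ≤ r) (θ : Fin n → ℝ) (k : ℕ) (j : Fin k → ℕ) (sg : Fin k → ℝ)
    (h : IsKnotSeq r n θ k j sg) (i : Fin k) :
    DD r θ (j i - 2) ≠ 0 ∧ sg i = Real.sign (DD r θ (j i - 2)) := by
  obtain ⟨hm, hb, hk, hs⟩ := h
  obtain ⟨r, rfl⟩ : ∃ r', r = r' + 1 := ⟨r - 1, by omega⟩
  have h1 := (hk (j i) (hb i).1 (hb i).2).2 ⟨i, rfl⟩
  have h2 := (hb i).1
  have e : j i - 2 + 1 = j i - 1 := by omega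
  rw [DD_succ, e, hs i]
  simp only [Nat.add_sub_cancel] at h1 ⊢
  refine ⟨fun h0 => h1 (by linarith), ?_⟩
  split_ifs with hlt
  · rw [Real.sign_of_pos (by linarith)]
  · rw [Real.sign_of_neg]
    have : DD r θ (j i - 1) < DD r θ (j i - 2) := lt_of_le_of_ne (not_lt.1 hlt) h1.symm
    linarith

lemma knot_exists (r n : ℕ) (hr : 1 ≤ r) (θ : Fin n → ℝ) (k : ℕ) (j : Fin k → ℕ)
    (sg : Fin k → ℝ) (h : IsKnotSeq r n θ k j sg) (t : ℕ) (ht : t < n - r) (h0 : DD r θ t ≠ 0) :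
    ∃ i, j i = t + 2 := by
  obtain ⟨hm, hb, hk, hs⟩ := h
  obtain ⟨r, rfl⟩ : ∃ r', r = r' + 1 := ⟨r - 1, by omega⟩
  apply (hk (t + 2) (by omega) (by omega)).1
  rw [DD_succ] at h0
  have e : t + 2 - 1 = t + 1 := by omega
  simp only [Nat.add_sub_cancel, e]
  intro h1
  apply h0
  rw [h1, sub_self]

lemma abs_sign_le (x : ℝ) : |Real.sign x| ≤ 1 := by
  rcases Real.sign_apply_eq x with h | h | h <;> rw [h] <;> norm_num

lemma abs_sgext_le (r n : ℕ) (hr : 1 ≤ r) (θ : Fin n → ℝ) (k : ℕ) (j : Fin k → ℕ)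
    (sg : Fin k → ℝ) (h : IsKnotSeq r n θ k j sg) (q : ℕ) : |sgext k sg q| ≤ 1 := by
  unfold sgext
  split_ifs with h1
  · rw [(sign_knot r n hr θ k j sg h _).2]; exact abs_sign_le _
  · simp

lemma exists_knotSeq (r n : ℕ) (θ : Fin n → ℝ) :
    ∃ (k : ℕ) (j : Fin k → ℕ) (sg : Fin k → ℝ), IsKnotSeq r n θ k j sg := by
  classical
  set s : Finset ℕ := (Finset.Icc 2 (n - r + 1)).filter
    (fun m => DD (r - 1) θ (m - 2) ≠ DD (r - 1) θ (m - 1)) with hs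
  refine ⟨s.card, s.orderEmbOfFin rfl, fun i =>
    if DD (r - 1) θ (s.orderEmbOfFin rfl i - 2) < DD (r - 1) θ (s.orderEmbOfFin rfl i - 1)
      then 1 else -1, (s.orderEmbOfFin rfl).strictMono, ?_, ?_, fun i => rfl⟩
  · intro i
    have := Finset.orderEmbOfFin_mem s rfl i
    exact Finset.mem_Icc.1 (Finset.mem_filter.1 this).1
  · intro m h1 h2
    have hr := Finset.range_orderEmbOfFin s rfl
    have : (∃ i, s.orderEmbOfFin rfl i = m) ↔ m ∈ s := by
      rw [← Finset.mem_coe, ← hr]; rfl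
    rw [this, hs, Finset.mem_filter, Finset.mem_Icc]
    tauto

/-! ### Summation by parts and averaging on `ℤ` -/

/-- backward difference -/
def bdiff (f : ℤ → ℝ) : ℤ → ℝ := fun t => f t - f (t - 1)

/-- moving average -/
def mavg (l : ℕ) (f : ℤ → ℝ) : ℤ → ℝ := fun t => (∑ a ∈ Finset.range l, f (t - a)) / l

/-- scaled long difference -/
def ldiff (l : ℕ) (f : ℤ → ℝ) : ℤ → ℝ := fun t => (f t - f (t - l)) / l

lemma bdiff_iter_zero (r : ℕ) : ∀ (N : ℤ) (W : ℤ → ℝ), (∀ t < 0, W t = 0) → (∀ t ≥ N, W t = 0) →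
    (∀ t < 0, bdiff^[r] W t = 0) ∧ (∀ t ≥ N + r, bdiff^[r] W t = 0) := by
  induction r with
  | zero => intro N W h1 h2; exact ⟨h1, fun t ht => h2 t (by simpa using ht)⟩
  | succ r ih =>
    intro N W h1 h2
    have h := ih (N + 1) (bdiff W) (fun t ht => by
        simp only [bdiff]; rw [h1 t ht, h1 (t - 1) (by omega), sub_zero])
      (fun t ht => by
        simp only [bdiff]; rw [h2 t (by omega), h2 (t - 1) (by omega), sub_zero])
    simp only [Function.iterate_succ_apply]
    refine ⟨h.1, fun t ht => h.2 t ?_⟩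
    push_cast at ht
    omega

lemma parts_one (V : ℤ → ℝ) (f : ℕ → ℝ) (h0 : V (-1) = 0) (M : ℕ) :
    ∑ i ∈ Finset.range M, V i * dseq f i =
      V M * f M - ∑ i ∈ Finset.range (M + 1), bdiff V i * f i := by
  induction M with
  | zero => simp [bdiff, h0]
  | succ M ih =>
    rw [Finset.sum_range_succ, ih, Finset.sum_range_succ _ (M + 1)]
    simp only [bdiff, dseq]
    have : ((M + 1 : ℕ) : ℤ) - 1 = M := by push_cast; ring
    rw [this]
    ring

lemma parts_iter (r : ℕ) : ∀ (N : ℕ) (W : ℤ → ℝ) (f : ℕ → ℝ), (∀ t < 0, W t = 0) →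
    (∀ t ≥ (N : ℤ), W t = 0) →
    ∑ t ∈ Finset.range N, W t * dseq^[r] f t =
      ∑ i ∈ Finset.range (N + r), (-1) ^ r * bdiff^[r] W i * f i := by
  induction r with
  | zero => intro N W f h1 h2; simp
  | succ r ih =>
    intro N W f h1 h2
    obtain ⟨z1, z2⟩ := bdiff_iter_zero r N W h1 h2
    rw [Function.iterate_succ_apply, ih N W (dseq f) h1 h2]
    have e1 : ∑ i ∈ Finset.range (N + r), (-1) ^ r * bdiff^[r] W i * dseq f i =
        (-1) ^ r * ∑ i ∈ Finset.range (N + r), bdiff^[r] W i * dseq f i := by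
      rw [Finset.mul_sum]; exact Finset.sum_congr rfl fun i _ => by ring
    rw [e1, parts_one _ _ (z1 (-1) (by norm_num)), z2 _ (by push_cast; omega),
      Function.iterate_succ_apply']
    rw [zero_mul, zero_sub, mul_neg, ← neg_mul, Finset.mul_sum]
    apply Finset.sum_congr (by rw [add_assoc])
    intro i _
    ring

lemma mavg_succ_mul (l : ℕ) (f : ℤ → ℝ) (t : ℤ) :
    (∑ a ∈ Finset.range l, f (t - a)) - ∑ a ∈ Finset.range l, f (t - 1 - a) = f t - f (t - l) := by
  induction l with
  | zero => simp
  | succ l ih =>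
    rw [Finset.sum_range_succ, Finset.sum_range_succ]
    have : t - 1 - (l : ℤ) = t - ((l + 1 : ℕ) : ℤ) := by push_cast; ring
    rw [this] at *
    linarith

lemma bdiff_mavg (l : ℕ) : bdiff ∘ mavg l = ldiff l := by
  funext f t
  simp only [Function.comp, bdiff, mavg, ldiff]
  rw [← sub_div, mavg_succ_mul]

lemma mavg_bdiff (l : ℕ) : Function.Commute bdiff (mavg l) := by
  intro f
  funext t
  simp only [bdiff, mavg]
  rw [← sub_div, ← Finset.sum_sub_distrib]
  congr 1
  apply Finset.sum_congr rfl
  intro a _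
  rw [sub_right_comm]

lemma bdiff_iter_mavg (l r : ℕ) (u : ℤ → ℝ) : bdiff^[r] ((mavg l)^[r] u) = (ldiff l)^[r] u := by
  rw [← bdiff_mavg, (mavg_bdiff l).comp_iterate]
  rfl

lemma abs_ldiff_iter (l : ℕ) (r : ℕ) : ∀ (M : ℝ) (u : ℤ → ℝ), (∀ t, |u t| ≤ M) →
    ∀ t, |(ldiff l)^[r] u t| ≤ (2 / l) ^ r * M := by
  induction r with
  | zero => intro M u h t; simpa using h t
  | succ r ih =>
    intro M u h t
    rw [Function.iterate_succ_apply]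
    refine le_trans (ih (2 / l * M) _ ?_ t) (le_of_eq (by ring))
    intro s
    simp only [ldiff]
    rw [abs_div, Nat.abs_cast, div_mul_eq_mul_div]
    gcongr
    refine le_trans (abs_sub _ _) ?_
    have := h s
    have := h (s - l)
    linarith

lemma ldiff_iter_zero (l : ℕ) (r : ℕ) : ∀ (u : ℤ → ℝ) (t : ℤ),
    (∀ s, t - (r : ℤ) * l ≤ s → s ≤ t → u s = 0) → (ldiff l)^[r] u t = 0 := by
  induction r with
  | zero => intro u t h; exact h t (by simp) le_rfl
  | succ r ih =>
    intro u t h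
    rw [Function.iterate_succ_apply]
    apply ih
    intro s h1 h2
    have e : ((r + 1 : ℕ) : ℤ) * l = r * l + l := by push_cast; ring
    rw [e] at h
    have hl : (0 : ℤ) ≤ l := by positivity
    simp only [ldiff]
    rw [h s (by linarith) h2, h (s - l) (by linarith) (by linarith)]
    simp

lemma ldiff_iter_const (l : ℕ) (r : ℕ) (hr : 1 ≤ r) (u : ℤ → ℝ) (t : ℤ)
    (h : ∀ s, t - (r : ℤ) * l ≤ s → s ≤ t → u s = u t) : (ldiff l)^[r] u t = 0 := by
  obtain ⟨r, rfl⟩ : ∃ r', r = r' + 1 := ⟨r - 1, by omega⟩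
  rw [Function.iterate_succ_apply]
  apply ldiff_iter_zero
  intro s h1 h2
  have e : ((r + 1 : ℕ) : ℤ) * l = r * l + l := by push_cast; ring
  rw [e] at h
  have hl : (0 : ℤ) ≤ l := by positivity
  simp only [ldiff]
  rw [h s (by linarith) h2, h (s - l) (by linarith) (by linarith)]
  simp

lemma mavg_iter_const (l : ℕ) (hl : 1 ≤ l) (r : ℕ) : ∀ (u : ℤ → ℝ) (t : ℤ) (c : ℝ),
    (∀ s, t - (r : ℤ) * (l - 1) ≤ s → s ≤ t → u s = c) → (mavg l)^[r] u t = c := by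
  induction r with
  | zero => intro u t c h; exact h t (by simp) le_rfl
  | succ r ih =>
    intro u t c h
    rw [Function.iterate_succ_apply]
    apply ih
    intro s h1 h2
    have e : ((r + 1 : ℕ) : ℤ) * (l - 1) = r * (l - 1) + (l - 1) := by push_cast; ring
    rw [e] at h
    simp only [mavg]
    have : ∀ a ∈ Finset.range l, u (s - a) = c := by
      intro a ha
      have ha' := Finset.mem_range.1 ha
      apply h
      · have : (a : ℤ) ≤ l - 1 := by omega
        linarith
      · have : (0 : ℤ) ≤ a := by positivity
        linarith
    rw [Finset.sum_congr rfl this]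
    have : (l : ℝ) ≠ 0 := by positivity
    simp
    field_simp

lemma abs_mavg_iter (l : ℕ) (hl : 1 ≤ l) (r : ℕ) : ∀ (u : ℤ → ℝ), (∀ t, |u t| ≤ 1) →
    ∀ t, |(mavg l)^[r] u t| ≤ 1 := by
  induction r with
  | zero => intro u h t; exact h t
  | succ r ih =>
    intro u h t
    rw [Function.iterate_succ_apply]
    apply ih
    intro s
    have hl0 : (0 : ℝ) < l := by positivity
    simp only [mavg]
    rw [abs_div, Nat.abs_cast, div_le_one hl0]
    refine le_trans (Finset.abs_sum_le_sum_abs _ _) ?_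
    refine le_trans (Finset.sum_le_sum fun a _ => h _) ?_
    simp

/-! ### The step function -/

open Classical in
/-- step function taking the value `S q` between `J (q-1) - 2` (excluded) and `J q - 2`. -/
def stepu (J : ℕ → ℕ) (S : ℕ → ℝ) : ℤ → ℝ := fun t =>
  if h : ∃ q, t + 2 ≤ (J q : ℤ) then S (Nat.find h) else 0

lemma stepu_eq (J : ℕ → ℕ) (S : ℕ → ℝ) (t : ℤ) (q : ℕ) (h1 : t + 2 ≤ J q)
    (h2 : ∀ p < q, (J p : ℤ) < t + 2) : stepu J S t = S q := by
  classical
  have h : ∃ q, t + 2 ≤ (J q : ℤ) := ⟨q, h1⟩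
  unfold stepu
  rw [dif_pos h]
  congr 1
  rw [Nat.find_eq_iff]
  exact ⟨h1, fun p hp => not_le.2 (h2 p hp)⟩

lemma stepu_zero (J : ℕ → ℕ) (S : ℕ → ℝ) (t : ℤ) (h : ∀ q, (J q : ℤ) < t + 2) :
    stepu J S t = 0 := by
  unfold stepu
  rw [dif_neg]
  push Not
  exact h

lemma stepu_abs (J : ℕ → ℕ) (S : ℕ → ℝ) (hS : ∀ q, |S q| ≤ 1) (t : ℤ) : |stepu J S t| ≤ 1 := by
  unfold stepu
  split_ifs
  · exact hS _
  · simp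

section step
variable (k : ℕ) (J : ℕ → ℕ) (S : ℕ → ℝ)

lemma J_mono (hJ : ∀ q ≤ k, J q < J (q + 1)) (hJ' : ∀ q, k + 1 ≤ q → J q = J (k + 1)) :
    Monotone J := by
  apply monotone_nat_of_le_succ
  intro q
  rcases Nat.lt_or_ge k q with h | h
  · rw [hJ' q (by omega), hJ' (q + 1) (by omega)]
  · exact (hJ q h).le

lemma J_lt (hJ : ∀ q ≤ k, J q < J (q + 1)) (hJ' : ∀ q, k + 1 ≤ q → J q = J (k + 1))
    (p q : ℕ) (hpq : p < q) (hq : q ≤ k + 1) : J p < J q :=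
  lt_of_lt_of_le (hJ p (by omega)) (J_mono k J hJ hJ' hpq)

lemma stepu_jump (hJ : ∀ q ≤ k, J q < J (q + 1)) (hJ' : ∀ q, k + 1 ≤ q → J q = J (k + 1))
    (hS : ∀ q, k + 1 ≤ q → S q = 0) (p : ℤ) (hp : stepu J S p ≠ stepu J S (p - 1)) :
    ∃ q ≤ k, (J q : ℤ) = p + 1 ∧ S q ≠ S (q + 1) := by
  classical
  have hmono := J_mono k J hJ hJ'
  have hle : ∀ q, J q ≤ J (k + 1) := by
    intro q
    rcases le_total q (k + 1) with h | h
    · exact hmono h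
    · exact (hJ' q h).le
  by_cases h : ∃ q, (p - 1) + 2 ≤ (J q : ℤ)
  · set q := Nat.find h with hq
    have h1 : (p - 1) + 2 ≤ (J q : ℤ) := Nat.find_spec h
    have h2 : ∀ p' < q, (J p' : ℤ) < (p - 1) + 2 := fun p' hp' => not_le.1 (Nat.find_min h hp')
    have e1 := stepu_eq J S (p - 1) q h1 h2
    by_cases h3 : p + 2 ≤ (J q : ℤ)
    · have e2 := stepu_eq J S p q h3 (fun p' hp' => by have := h2 p' hp'; omega)
      exact absurd (e2.trans e1.symm) hp
    · have e3 : (J q : ℤ) = p + 1 := by omega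
      rcases Nat.lt_or_ge k q with hqk | hqk
      · exfalso
        apply hp
        rw [e1, hS q (by omega)]
        apply stepu_zero
        intro q'
        have := hle q'
        have := hJ' q (by omega)
        omega
      · refine ⟨q, hqk, e3, ?_⟩
        have e2 := stepu_eq J S p (q + 1) (by have := hJ q hqk; omega) (fun p' hp' => by
          have := hmono (Nat.lt_succ_iff.1 hp')
          omega)
        rw [e1, e2] at hp
        exact hp.symm
  · exfalso
    apply hp
    push Not at h
    rw [stepu_zero J S (p - 1) h, stepu_zero J S p (fun q => by have := h q; omega)]

lemma exists_jump (u : ℤ → ℝ) (s t : ℤ) (hst : s ≤ t) (h : u s ≠ u t) :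
    ∃ p, s < p ∧ p ≤ t ∧ u p ≠ u (p - 1) := by
  by_contra hc
  push Not at hc
  apply h
  have : ∀ m : ℕ, s + m ≤ t → u (s + m) = u s := by
    intro m
    induction m with
    | zero => simp
    | succ m ih =>
      intro hm
      push_cast at hm ⊢
      rw [hc (s + (m + 1)) (by omega) (by omega), ← ih (by omega)]
      congr 1; ring
  have h2 := this (t - s).toNat (by omega)
  rw [← h2]
  congr 1; omega

lemma stepu_window (hJ : ∀ q ≤ k, J q < J (q + 1)) (hJ' : ∀ q, k + 1 ≤ q → J q = J (k + 1))
    (hS : ∀ q, k + 1 ≤ q → S q = 0) (E : ℕ)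
    (hE : ∀ q ≤ k, S q ≠ S (q + 1) → J q + E + 1 ≤ J (q + 1))
    (t : ℤ) (ht : (∃ q ≤ k + 1, (J q : ℤ) = t + 2) ∨ t + 2 ≤ J 0 ∨ J (k + 1) ≤ t + 2)
    (s : ℤ) (h1 : t - E ≤ s) (h2 : s ≤ t) : stepu J S s = stepu J S t := by
  by_contra hne
  obtain ⟨p, hp1, hp2, hp⟩ := exists_jump _ s t h2 hne
  obtain ⟨q, hq, hJq, hSq⟩ := stepu_jump k J S hJ hJ' hS p hp
  have hEq := hE q hq hSq
  have hmono := J_mono k J hJ hJ'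
  rcases ht with ⟨q', hq', hq2⟩ | ht | ht
  · have : q < q' := by
      by_contra hcon
      have := hmono (not_lt.1 hcon)
      omega
    have := hmono (Nat.succ_le_of_lt this)
    simp only [Nat.succ_eq_add_one] at this
    omega
  · have := hmono (Nat.zero_le q)
    omega
  · have := hmono (Nat.succ_le_succ hq)
    simp only [Nat.succ_eq_add_one] at this
    omega

end step

/-! ### The upper bound -/

lemma sign_mul_self' (x : ℝ) : Real.sign x * x = |x| := by
  rcases lt_trichotomy x 0 with h | h | h
  · rw [Real.sign_of_neg h, abs_of_neg h]; ring
  · rw [h]; simp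
  · rw [Real.sign_of_pos h, abs_of_pos h]; ring

lemma upper_exists (r : ℕ) (hr : 1 ≤ r) (n : ℕ) (hn : r + 1 ≤ n) (θ : Fin n → ℝ)
    (k : ℕ) (j : Fin k → ℕ) (sg : Fin k → ℝ) (hk : IsKnotSeq r n θ k j sg) (l : ℕ) (hl : 1 ≤ l)
    (hE : ∀ q ≤ k, sgext k sg q ≠ sgext k sg (q + 1) →
      jext n r k j q + r * (l - 1) + 1 ≤ jext n r k j (q + 1)) :
    ∃ v ∈ subdiff (fun α => Dl1 r α) θ,
      sqnorm v ≤ ((k : ℝ) + 1) * (r * l) * ((2 / (l : ℝ)) ^ r) ^ 2 := by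
  classical
  set J := jext n r k j with hJdef
  set S := sgext k sg with hSdef
  have hJ : ∀ q ≤ k, J q < J (q + 1) := jext_strict r n θ k j sg hk
  have hJl : ∀ q, k + 1 ≤ q → J q = n - r + 2 := jext_last n r k j
  have hJ' : ∀ q, k + 1 ≤ q → J q = J (k + 1) := by
    intro q hq; rw [hJl q hq, hJl (k + 1) le_rfl]
  have hS : ∀ q, k + 1 ≤ q → S q = 0 := sgext_last k sg
  have hS1 : ∀ q, |S q| ≤ 1 := abs_sgext_le r n hr θ k j sg hk
  have hJ0 : J 0 = 1 := rfl
  set u := stepu J S with hu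
  have hu1 : ∀ t, |u t| ≤ 1 := stepu_abs J S hS1
  set W := (mavg l)^[r] u with hW
  have hcast : ((r * (l - 1) : ℕ) : ℤ) = (r : ℤ) * ((l : ℤ) - 1) := by
    rw [Nat.cast_mul, Nat.cast_sub hl]; simp
  have hwin : ∀ t : ℤ, ((∃ q ≤ k + 1, (J q : ℤ) = t + 2) ∨ t + 2 ≤ J 0 ∨ J (k + 1) ≤ t + 2) →
      W t = u t := by
    intro t ht
    apply mavg_iter_const l hl
    intro s h1 h2
    exact stepu_window k J S hJ hJ' hS (r * (l - 1)) hE t ht s (by rw [hcast]; exact h1) h2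
  have hWneg : ∀ t < 0, W t = 0 := by
    intro t ht
    rw [hwin t (Or.inr (Or.inl (by rw [hJ0]; push_cast; omega)))]
    rw [hu, stepu_eq J S t 0 (by rw [hJ0]; push_cast; omega) (by simp)]
    exact sgext_zero k sg
  have hWpos : ∀ t ≥ ((n - r : ℕ) : ℤ), W t = 0 := by
    intro t ht
    have h1 : (J (k + 1) : ℤ) ≤ t + 2 := by rw [hJl _ le_rfl]; push_cast; omega
    rw [hwin t (Or.inr (Or.inr h1))]
    rcases eq_or_lt_of_le h1 with h2 | h2
    · rw [hu, stepu_eq J S t (k + 1) h2.ge (fun p hp => by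
        have := J_lt k J hJ hJ' p (k + 1) hp le_rfl
        omega)]
      exact hS _ le_rfl
    · apply stepu_zero
      intro q
      rcases le_total q (k + 1) with h | h
      · have := J_mono k J hJ hJ' h
        omega
      · rw [hJ' q h]; exact h2
  refine ⟨fun i => (-1) ^ r * bdiff^[r] W i, ?_, ?_⟩
  · apply mem_subdiff_of r θ _ (fun t => W t)
    · intro t _
      exact abs_mavg_iter l hl r u hu1 t
    · intro t ht
      by_cases h0 : DD r θ t = 0
      · simp [h0]
      · obtain ⟨i, hi⟩ := knot_exists r n hr θ k j sg hk t ht h0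
        have hJi : J (i + 1) = t + 2 := by rw [hJdef, jext_succ, hi]
        have hsi := (sign_knot r n hr θ k j sg hk i).2
        rw [hi, Nat.add_sub_cancel] at hsi
        have h1 : W t = u t := hwin t (Or.inl ⟨i + 1, by have := i.2; omega, by
          rw [hJi]; push_cast; rfl⟩)
        have h2 : u t = S (i + 1) := by
          apply stepu_eq
          · rw [hJi]; push_cast; exact le_rfl
          · intro p hp
            have := J_lt k J hJ hJ' p (i + 1) hp (by have := i.2; omega)
            omega
        have h3 : S (i + 1) = sg i := sgext_succ k sg i
        rw [h1, h2, h3, hsi, sign_mul_self']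
    · intro y
      have h := parts_iter r (n - r) W (pad y) hWneg hWpos
      rw [sum_pad (fun i : ℕ => (-1) ^ r * bdiff^[r] W i) y]
      have e : n - r + r = n := by omega
      rw [e] at h
      exact h.symm
  · have hval : ∀ i : ℕ, ((-1 : ℝ) ^ r * bdiff^[r] W i) ^ 2 = ((ldiff l)^[r] u i) ^ 2 := by
      intro i
      rw [hW, bdiff_iter_mavg, mul_pow, ← pow_mul, mul_comm r 2, pow_mul]
      simp
    unfold sqnorm
    rw [Finset.sum_congr rfl fun (i : Fin n) _ => hval i,
      Fin.sum_univ_eq_sum_range (fun i : ℕ => ((ldiff l)^[r] u i) ^ 2) n]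
    set A : Finset ℕ := (Finset.range (k + 1)).biUnion
      (fun q => Finset.Ico (J q - 1) (J q - 1 + r * l)) with hA
    have hAc : A.card ≤ (k + 1) * (r * l) := by
      have := Finset.card_biUnion_le_card_mul (Finset.range (k + 1))
        (fun q => Finset.Ico (J q - 1) (J q - 1 + r * l)) (r * l) (by intro q _; simp)
      simpa using this
    have hbd : ∀ i : ℕ, ((ldiff l)^[r] u i) ^ 2 ≤ ((2 / (l : ℝ)) ^ r) ^ 2 := by
      intro i
      have := abs_ldiff_iter l r 1 u hu1 i
      rw [mul_one] at this
      rw [← sq_abs]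
      gcongr
    have hz : ∀ i : ℕ, i ∉ A → ((ldiff l)^[r] u i) ^ 2 = 0 := by
      intro i hi
      rw [ldiff_iter_const l r hr u i, zero_pow two_ne_zero]
      intro s h1 h2
      by_contra hne
      apply hi
      obtain ⟨p, hp1, hp2, hp⟩ := exists_jump _ s i h2 hne
      obtain ⟨q, hq, hJq, -⟩ := stepu_jump k J S hJ hJ' hS p hp
      rw [hA, Finset.mem_biUnion]
      refine ⟨q, Finset.mem_range.2 (by omega), ?_⟩
      have := J_mono k J hJ hJ' (Nat.zero_le q)
      have e : ((r * l : ℕ) : ℤ) = (r : ℤ) * l := by push_cast; ring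
      rw [← e] at h1
      rw [Finset.mem_Ico]
      omega
    calc ∑ i ∈ Finset.range n, ((ldiff l)^[r] u i) ^ 2
        ≤ ∑ i ∈ Finset.range n, (if i ∈ A then ((2 / (l : ℝ)) ^ r) ^ 2 else 0) := by
          apply Finset.sum_le_sum
          intro i _
          split_ifs with h
          · exact hbd i
          · exact (hz i h).le
      _ = ((Finset.range n).filter (· ∈ A)).card * ((2 / (l : ℝ)) ^ r) ^ 2 := by
          rw [← Finset.sum_filter, Finset.sum_const, nsmul_eq_mul]
      _ ≤ A.card * ((2 / (l : ℝ)) ^ r) ^ 2 := by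
          gcongr
          intro i hi
          exact (Finset.mem_filter.1 hi).2
      _ ≤ _ := by
          gcongr
          exact_mod_cast hAc

lemma upper_bound (r : ℕ) (hr : 2 ≤ r) (n : ℕ) (hn : r + 1 ≤ n) (θ : Fin n → ℝ)
    (vstar : Fin n → ℝ) (hv : IsMinNormIn vstar (subdiff (fun α => Dl1 r α) θ))
    (c : ℝ) (hc : 0 < c)
    (k : ℕ) (j : Fin k → ℕ) (sg : Fin k → ℝ) (hk : IsKnotSeq r n θ k j sg)
    (hm : MinLen n r k j sg c) :
    eunorm vstar ≤ ((2 : ℝ) ^ r * (r : ℝ) ^ (2 * r)) * c ^ (-(r : ℝ) + 1 / 2) *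
      ((k : ℝ) + 1) ^ r * (n : ℝ) ^ (-(r : ℝ) + 1 / 2) := by
  have hn0 : (0 : ℝ) < n := by
    have : 0 < n := by omega
    exact_mod_cast this
  have hr0 : (0 : ℝ) < r := by
    have : 0 < r := by omega
    exact_mod_cast this
  have hk0 : (0 : ℝ) < (k : ℝ) + 1 := by positivity
  set L : ℝ := c * n / ((k : ℝ) + 1) with hL
  have hL0 : 0 < L := by positivity
  set l : ℕ := ⌈L / (r : ℝ) ^ 2⌉₊ with hl
  have hl1 : 1 ≤ l := Nat.ceil_pos.2 (by positivity)
  have hlL : L / (r : ℝ) ^ 2 ≤ l := Nat.le_ceil _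
  have hlt : ((l - 1 : ℕ) : ℝ) < L / (r : ℝ) ^ 2 := Nat.lt_ceil.1 (by omega)
  have hEL : ((r * (r * (l - 1)) : ℕ) : ℝ) < L := by
    rw [lt_div_iff₀ (by positivity)] at hlt
    push_cast
    nlinarith
  obtain ⟨v, hvm, hvn⟩ := upper_exists r (by omega) n hn θ k j sg hk l hl1 (by
    intro q hq hne
    have h1 := lt_of_lt_of_le hEL (hm q hq hne)
    have h2 : r * (r * (l - 1)) < nlen n r k j q := by exact_mod_cast h1
    have h3 := jext_strict r n θ k j sg hk q hq
    set E := r * (l - 1) with hE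
    unfold nlen at h2
    split_ifs at h2 with h0
    · subst h0
      rw [jext_zero] at h3 ⊢
      simp only [zero_add] at *
      by_contra hcon
      obtain ⟨m, hm'⟩ : ∃ m, jext n r k j 1 = m + 2 := ⟨jext n r k j 1 - 2, by omega⟩
      rw [hm'] at h2 hcon
      have h4 : m + 1 ≤ E := by omega
      have h5 : r * (m + 1) ≤ r * E := Nat.mul_le_mul_left _ h4
      have h6 : 1 * m ≤ r * m := Nat.mul_le_mul_right _ (by omega)
      rw [Nat.mul_add] at h5
      omega
    · have h6 : 1 * E ≤ r * E := Nat.mul_le_mul_right _ (by omega)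
      omega)
  refine le_trans (hv.2 v hvm) ?_
  apply Real.sqrt_le_iff.2
  refine ⟨by positivity, le_trans hvn ?_⟩
  have hl0 : (0 : ℝ) < l := by exact_mod_cast hl1
  have e1 : (((2 : ℝ) ^ r * (r : ℝ) ^ (2 * r)) * c ^ (-(r : ℝ) + 1 / 2) *
      ((k : ℝ) + 1) ^ r * (n : ℝ) ^ (-(r : ℝ) + 1 / 2)) ^ 2 =
      ((2 : ℝ) ^ r) ^ 2 * (((r : ℝ) ^ (2 * r)) ^ 2 * (((k : ℝ) + 1) ^ r) ^ 2 *
        ((c * n) ^ (2 * r - 1))⁻¹) := by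
    rw [mul_pow, mul_pow, mul_pow, mul_pow, rpow_half_sq c hc r (by omega),
      rpow_half_sq n hn0 r (by omega), mul_pow c, mul_inv]
    ring
  rw [e1]
  obtain ⟨s, rfl⟩ : ∃ s, r = s + 1 := ⟨r - 1, by omega⟩
  set R : ℝ := ((s + 1 : ℕ) : ℝ) with hR
  have hR1 : 1 ≤ R := by rw [hR]; push_cast; have : (0 : ℝ) ≤ s := by positivity
                         linarith
  have e2 : 2 * (s + 1) - 1 = 2 * s + 1 := by omega
  rw [e2]
  have e3 : ((k : ℝ) + 1) * (R * l) * ((2 / (l : ℝ)) ^ (s + 1)) ^ 2 =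
      (2 ^ (s + 1)) ^ 2 * (((k : ℝ) + 1) * R * ((l : ℝ) ^ (2 * s + 1))⁻¹) := by
    rw [div_pow, div_pow]
    field_simp
    ring
  rw [e3]
  gcongr ?_ * ?_
  have e4 : ((l : ℝ) ^ (2 * s + 1))⁻¹ ≤ ((L / R ^ 2) ^ (2 * s + 1))⁻¹ := by
    gcongr
  have e5 : ((L / R ^ 2) ^ (2 * s + 1))⁻¹ =
      ((k : ℝ) + 1) ^ (2 * s + 1) * (R ^ 2) ^ (2 * s + 1) * ((c * n) ^ (2 * s + 1))⁻¹ := by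
    rw [hL, div_div, div_pow, inv_div, mul_pow, div_eq_mul_inv]
  calc ((k : ℝ) + 1) * R * ((l : ℝ) ^ (2 * s + 1))⁻¹
      ≤ ((k : ℝ) + 1) * R * ((L / R ^ 2) ^ (2 * s + 1))⁻¹ := by gcongr
    _ = (R ^ (4 * s + 3) * (((k : ℝ) + 1) ^ (s + 1)) ^ 2) * ((c * n) ^ (2 * s + 1))⁻¹ := by
      rw [e5]; ring
    _ ≤ _ := by
      gcongr
      rw [← pow_mul]
      exact pow_le_pow_right₀ hR1 (by omega)

/-! ### The case `r = 1` -/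

lemma eq_of_min {n : ℕ} (v v' : Fin n → ℝ) (T : ℝ) (h1 : ∑ i, v i * v i = T)
    (h2 : ∑ i, v i * v' i = T) (h3 : eunorm v' ≤ eunorm v) : v' = v := by
  have h4 := sqnorm_le_of h3
  have h5 : sqnorm v = T := by
    rw [← h1]; exact Finset.sum_congr rfl fun i _ => by ring
  have h6 : ∑ i, (v' i - v i) ^ 2 = sqnorm v' - 2 * (∑ i, v i * v' i) + sqnorm v := by
    unfold sqnorm
    rw [Finset.mul_sum, ← Finset.sum_sub_distrib, ← Finset.sum_add_distrib]
    exact Finset.sum_congr rfl fun i _ => by ring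
  have h7 : ∑ i, (v' i - v i) ^ 2 = 0 := by
    apply le_antisymm
    · rw [h6, h2]; linarith
    · exact Finset.sum_nonneg fun _ _ => sq_nonneg _
  rw [Finset.sum_eq_zero_iff_of_nonneg fun _ _ => sq_nonneg _] at h7
  funext i
  have := pow_eq_zero_iff (two_ne_zero) |>.1 (h7 i (Finset.mem_univ i))
  linarith

lemma final_sum (n : ℕ) (θ : Fin n → ℝ) (k : ℕ) (hk1 : 1 ≤ k) (j : Fin k → ℕ) (sg : Fin k → ℝ)
    (hk : IsKnotSeq 1 n θ k j sg) :
    ∑ q ∈ Finset.range (k + 1), (sgext k sg q - sgext k sg (q + 1)) ^ 2 / (nlen n 1 k j q : ℝ) =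
      1 / (nlen n 1 k j 0 : ℝ) + 1 / (nlen n 1 k j k : ℝ) + 4 * ∑ i ∈ Finset.Ico 1 k,
        (if sgext k sg i ≠ sgext k sg (i + 1) then 1 / (nlen n 1 k j i : ℝ) else 0) := by
  have hs : ∀ q, 1 ≤ q → q ≤ k → sgext k sg q = 1 ∨ sgext k sg q = -1 := by
    intro q h1 h2
    have h := sgext_succ k sg ⟨q - 1, by omega⟩
    have e : q - 1 + 1 = q := by omega
    simp only [e] at h
    rw [h, hk.2.2.2]
    split_ifs <;> simp
  rw [Finset.sum_range_succ, Finset.range_eq_Ico, Finset.sum_eq_sum_Ico_succ_bot (by omega)]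
  rw [sgext_zero, sgext_last k sg (k + 1) le_rfl, zero_add]
  have e1 : (0 - sgext k sg 1) ^ 2 = 1 := by
    rcases hs 1 le_rfl hk1 with h | h <;> rw [h] <;> norm_num
  have e2 : (sgext k sg k - 0) ^ 2 = 1 := by
    rcases hs k hk1 le_rfl with h | h <;> rw [h] <;> norm_num
  rw [e1, e2, Finset.mul_sum]
  have e3 : ∑ i ∈ Finset.Ico 1 k, (sgext k sg i - sgext k sg (i + 1)) ^ 2 / (nlen n 1 k j i : ℝ) =
      ∑ i ∈ Finset.Ico 1 k, 4 * (if sgext k sg i ≠ sgext k sg (i + 1) then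
        1 / (nlen n 1 k j i : ℝ) else 0) := by
    apply Finset.sum_congr rfl
    intro i hi
    rw [Finset.mem_Ico] at hi
    rcases hs i hi.1 hi.2.le with h | h <;> rcases hs (i + 1) (by omega) hi.2 with h' | h' <;>
      rw [h, h'] <;> norm_num <;> ring
  rw [e3]
  ring

lemma abel (v Y : ℕ → ℝ) (m : ℕ) :
    ∑ x ∈ Finset.range (m + 1), v x * Y x = (∑ x ∈ Finset.range (m + 1), v x) * Y m -
      ∑ t ∈ Finset.range m, (∑ x ∈ Finset.range (t + 1), v x) * dseq Y t := by
  induction m with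
  | zero => simp
  | succ m ih =>
    rw [Finset.sum_range_succ, ih, Finset.sum_range_succ _ (m + 1),
      Finset.sum_range_succ (fun t => (∑ x ∈ Finset.range (t + 1), v x) * dseq Y t) m]
    simp only [dseq]
    ring

lemma sum_pieces (a : ℕ → ℕ) (h0 : a 0 = 0) (F : ℕ → ℝ) (Q : ℕ) (ha : ∀ q < Q, a q ≤ a (q + 1)) :
    ∑ x ∈ Finset.range (a Q), F x =
      ∑ q ∈ Finset.range Q, ∑ x ∈ Finset.Ico (a q) (a (q + 1)), F x := by
  induction Q with
  | zero => simp [h0]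
  | succ Q ih =>
    rw [Finset.sum_range_succ, ← ih (fun q hq => ha q (by omega)),
      Finset.sum_range_add_sum_Ico _ (ha Q (by omega))]

lemma exists_piecewise (a : ℕ → ℕ) (ha : Monotone a) (d : ℕ → ℝ) :
    ∃ v : ℕ → ℝ, ∀ q x, a q ≤ x → x < a (q + 1) → v x = d q := by
  classical
  refine ⟨fun x => if h : ∃ q, x < a (q + 1) then d (Nat.find h) else 0, ?_⟩
  intro q x h1 h2
  have h : ∃ q, x < a (q + 1) := ⟨q, h2⟩
  simp only [dif_pos h]
  congr 1
  rw [Nat.find_eq_iff]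
  exact ⟨h2, fun p hp => by have := ha (Nat.succ_le_of_lt hp); simp only [Nat.succ_eq_add_one] at this; omega⟩

lemma exists_piece (a : ℕ → ℕ) (h0 : a 0 = 0) (k m : ℕ) (hm : m < a (k + 1)) :
    ∃ q ≤ k, a q ≤ m ∧ m < a (q + 1) := by
  induction k with
  | zero => exact ⟨0, le_rfl, by omega, hm⟩
  | succ k ih =>
    rcases Nat.lt_or_ge m (a (k + 1)) with h | h
    · obtain ⟨q, hq, h1⟩ := ih h
      exact ⟨q, by omega, h1⟩
    · exact ⟨k + 1, le_rfl, h, hm⟩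

lemma part_one (n : ℕ) (hn : 1 + 1 ≤ n) (θ : Fin n → ℝ) (k : ℕ) (j : Fin k → ℕ) (sg : Fin k → ℝ)
    (hk : IsKnotSeq 1 n θ k j sg) :
    ∃ v ∈ subdiff (fun α => Dl1 1 α) θ,
      ∀ v' ∈ (affineSpan ℝ (subdiff (fun α => Dl1 1 α) θ) : Set (Fin n → ℝ)),
        ∑ i, v i * v' i = ∑ q ∈ Finset.range (k + 1),
          (sgext k sg q - sgext k sg (q + 1)) ^ 2 / (nlen n 1 k j q : ℝ) := by
  set J := jext n 1 k j with hJdef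
  set S := sgext k sg with hSdef
  have hJ : ∀ q ≤ k, J q < J (q + 1) := jext_strict 1 n θ k j sg hk
  have hJl : ∀ q, k + 1 ≤ q → J q = n - 1 + 2 := jext_last n 1 k j
  have hJ' : ∀ q, k + 1 ≤ q → J q = J (k + 1) := by
    intro q hq; rw [hJl q hq, hJl (k + 1) le_rfl]
  have hJ0 : J 0 = 1 := rfl
  have hmono := J_mono k J hJ hJ'
  have hJ1 : ∀ q, 1 ≤ J q := fun q => by rw [← hJ0]; exact hmono (Nat.zero_le q)
  have hS1 : ∀ q, |S q| ≤ 1 := abs_sgext_le 1 n le_rfl θ k j sg hk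
  have hS0 : S 0 = 0 := sgext_zero k sg
  have hSl : S (k + 1) = 0 := sgext_last k sg _ le_rfl
  obtain ⟨a, ha⟩ : ∃ a : ℕ → ℕ, ∀ q, a q = J q - 1 := ⟨fun q => J q - 1, fun _ => rfl⟩
  have ha0 : a 0 = 0 := by rw [ha, hJ0]
  have hal : a (k + 1) = n := by rw [ha, hJl _ le_rfl]; omega
  have hmonoa : Monotone a := by
    intro p q hpq
    have := hmono hpq
    rw [ha, ha]; omega
  have hastr : ∀ q ≤ k, a q < a (q + 1) := by
    intro q hq
    have := hJ q hq
    have := hJ1 q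
    rw [ha, ha]; omega
  have hnl : ∀ q ≤ k, (nlen n 1 k j q : ℝ) = (a (q + 1) : ℝ) - a q := by
    intro q hq
    rw [← Nat.cast_sub (hastr q hq).le]
    congr 1
    have := hJ1 q
    have := hJ q hq
    unfold nlen
    split_ifs with h
    · subst h
      rw [ha, ha0, ← hJdef]; simp only [zero_add]; omega
    · rw [ha, ha, ← hJdef]; omega
  have hnl0 : ∀ q ≤ k, (0 : ℝ) < (nlen n 1 k j q : ℝ) := by
    intro q hq
    rw [hnl q hq, sub_pos]
    exact_mod_cast hastr q hq
  obtain ⟨v, hv⟩ := exists_piecewise a hmonoa (fun q => (S q - S (q + 1)) / (nlen n 1 k j q : ℝ))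
  have hpart : ∀ q m, a q ≤ m → m ≤ a (q + 1) → ∑ x ∈ Finset.Ico (a q) m, v x =
      ((m : ℝ) - a q) * ((S q - S (q + 1)) / (nlen n 1 k j q : ℝ)) := by
    intro q m h1 h2
    rw [Finset.sum_congr rfl fun x hx => hv q x (Finset.mem_Ico.1 hx).1
      (lt_of_lt_of_le (Finset.mem_Ico.1 hx).2 h2), Finset.sum_const, Nat.card_Ico, nsmul_eq_mul,
      Nat.cast_sub h1]
  have hWa : ∀ q ≤ k + 1, ∑ x ∈ Finset.range (a q), v x = - S q := by
    intro q hq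
    rw [sum_pieces a ha0 v q (fun p hp => hmonoa (Nat.le_succ p))]
    rw [Finset.sum_congr rfl fun p hp => hpart p _ (hmonoa (Nat.le_succ p)) le_rfl]
    have : ∀ p ∈ Finset.range q, ((a (p + 1) : ℝ) - a p) *
        ((S p - S (p + 1)) / (nlen n 1 k j p : ℝ)) = S p - S (p + 1) := by
      intro p hp
      have hpk : p ≤ k := by have := Finset.mem_range.1 hp; omega
      have h0 := hnl0 p hpk
      rw [← hnl p hpk]
      field_simp
    have e : ∀ p, a p.succ = a (p + 1) := fun _ => rfl
    simp only [e]
    rw [Finset.sum_congr rfl this, Finset.sum_range_sub', hS0, zero_sub]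
  refine ⟨fun i => v i, ?_, ?_⟩
  · apply mem_subdiff_of 1 θ _ (fun t => - ∑ x ∈ Finset.range (t + 1), v x)
    · intro t ht
      obtain ⟨q, hq, h1, h2⟩ := exists_piece a ha0 k (t + 1) (by omega)
      rw [← Finset.sum_range_add_sum_Ico v h1, hWa q (by omega), hpart q _ h1 h2.le]
      have hp := hnl0 q hq
      have hp2 := hnl q hq
      set lam : ℝ := (((t + 1 : ℕ) : ℝ) - a q) / (nlen n 1 k j q : ℝ) with hlam
      have h1' : ((a q : ℕ) : ℝ) ≤ ((t + 1 : ℕ) : ℝ) := by exact_mod_cast h1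
      have h2' : ((t + 1 : ℕ) : ℝ) ≤ ((a (q + 1) : ℕ) : ℝ) := by exact_mod_cast h2.le
      have l0 : 0 ≤ lam := div_nonneg (by linarith) hp.le
      have l1 : lam ≤ 1 := by rw [hlam, div_le_one hp]; linarith
      have e : -(-S q + (((t + 1 : ℕ) : ℝ) - a q) * ((S q - S (q + 1)) / (nlen n 1 k j q : ℝ))) =
          (1 - lam) * S q + lam * S (q + 1) := by rw [hlam]; ring
      rw [e]
      have b1 := abs_le.1 (hS1 q)
      have b2 := abs_le.1 (hS1 (q + 1))
      rw [abs_le]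
      constructor <;> nlinarith
    · intro t ht
      by_cases h0 : DD 1 θ t = 0
      · simp [h0]
      · obtain ⟨i, hi⟩ := knot_exists 1 n le_rfl θ k j sg hk t ht h0
        have hJi : J (i + 1) = t + 2 := by rw [hJdef, jext_succ, hi]
        have hai : a (i + 1) = t + 1 := by rw [ha, hJi]; omega
        have hsi := (sign_knot 1 n le_rfl θ k j sg hk i).2
        rw [hi, Nat.add_sub_cancel] at hsi
        have h3 : S (i + 1) = sg i := sgext_succ k sg i
        rw [← hai, hWa _ (by have := i.2; omega), neg_neg, h3, hsi, sign_mul_self']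
    · intro y
      obtain ⟨m, rfl⟩ : ∃ m, n = m + 1 := ⟨n - 1, by omega⟩
      rw [sum_pad v y, abel]
      have : ∑ x ∈ Finset.range (m + 1), v x = 0 := by
        rw [← hal, hWa _ le_rfl, hSl, neg_zero]
      rw [this, zero_mul, zero_sub, ← Finset.sum_neg_distrib]
      apply Finset.sum_congr rfl
      intro t _
      rw [neg_mul]
      rfl
  · intro v' hv'
    have hcum : ∀ q ≤ k + 1, ∑ x ∈ Finset.range (a q), pad v' x = - S q := by
      intro q hq
      set f : ℕ → ℝ := fun s => if s < a q then 1 else 0 with hf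
      have hD : ∀ t < n - 1, DD 1 (fun i : Fin n => f i) t = if t + 1 = a q then -1 else 0 := by
        intro t ht
        rw [DD_restrict 1 f t (by omega)]
        simp only [Function.iterate_one, dseq, hf]
        rcases lt_trichotomy (t + 1) (a q) with h | h | h
        · rw [if_pos h, if_pos (by omega), if_neg (by omega), sub_self]
        · rw [if_neg (by omega), if_pos (by omega), if_pos h, zero_sub]
        · rw [if_neg (by omega), if_neg (by omega), if_neg (by omega), sub_self]
      have hknot : ∀ t < n - 1, t + 1 = a q → DD 1 θ t ≠ 0 ∧ Real.sign (DD 1 θ t) = S q := by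
        intro t ht htq
        have hq0 : q ≠ 0 := by rintro rfl; omega
        have hqk : q ≠ k + 1 := by rintro rfl; omega
        obtain ⟨i, rfl⟩ : ∃ i : Fin k, q = i + 1 := ⟨⟨q - 1, by omega⟩, by simp; omega⟩
        have hJi : J (i + 1) = j i := jext_succ n 1 k j i
        have h := sign_knot 1 n le_rfl θ k j sg hk i
        have e : j i - 2 = t := by rw [ha, hJi] at htq; omega
        rw [e] at h
        exact ⟨h.1, by rw [← h.2]; exact (sgext_succ k sg i).symm⟩
      have hp := aff_pair 1 θ v' (fun i : Fin n => f i) hv' (by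
        intro t ht h0
        rw [hD t ht, if_neg]
        intro h
        exact (hknot t ht h).1 h0)
      have e1 : ∑ i : Fin n, v' i * f i = ∑ x ∈ Finset.range (a q), pad v' x := by
        have e2 : ∑ i : Fin n, v' i * f i = ∑ i : Fin n, f i * v' i :=
          Finset.sum_congr rfl fun i _ => mul_comm _ _
        have haq : a q ≤ n := by rw [← hal]; exact hmonoa hq
        rw [e2, sum_pad f v']
        simp only [hf, ite_mul, one_mul, zero_mul]
        rw [← Finset.sum_filter]
        congr 1
        ext x
        simp only [Finset.mem_filter, Finset.mem_range]
        omega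
      rw [← e1, hp]
      have e3 : ∀ t ∈ Finset.range (n - 1), Real.sign (DD 1 θ t) * DD 1 (fun i : Fin n => f i) t =
          if t + 1 = a q then - S q else 0 := by
        intro t ht
        have ht' := Finset.mem_range.1 ht
        rw [hD t ht']
        split_ifs with h
        · rw [(hknot t ht' h).2]; ring
        · ring
      rw [Finset.sum_congr rfl e3]
      by_cases hq0 : q = 0
      · subst hq0; rw [ha0, hS0]; simp
      by_cases hqk : q = k + 1
      · subst hqk; rw [hSl]; simp
      have h1 : a q < n := by
        rw [← hal]
        exact lt_of_lt_of_le (hastr q (by omega)) (hmonoa (by omega))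
      have h2 : 0 < a q := by
        have := hastr 0 (by omega)
        have := hmonoa (show 0 + 1 ≤ q by omega)
        omega
      rw [Finset.sum_eq_single (a q - 1)]
      · rw [if_pos (by omega)]
      · intro t _ hne
        rw [if_neg (by omega)]
      · intro h
        exact absurd (Finset.mem_range.2 (by omega)) h
    have hsp := sum_pieces a ha0 (fun x => v x * pad v' x) (k + 1)
      (fun p _ => hmonoa (Nat.le_succ p))
    rw [hal] at hsp
    rw [sum_pad v v', hsp]
    apply Finset.sum_congr rfl
    intro q hq
    have hqk : q ≤ k := by have := Finset.mem_range.1 hq; omega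
    rw [Finset.sum_congr rfl fun x hx => by
      rw [hv q x (Finset.mem_Ico.1 hx).1 (Finset.mem_Ico.1 hx).2], ← Finset.mul_sum]
    have h1 := Finset.sum_range_add_sum_Ico (pad v') (hastr q hqk).le
    rw [hcum q (by omega), hcum (q + 1) (by omega)] at h1
    have h2 : ∑ x ∈ Finset.Ico (a q) (a (q + 1)), pad v' x = S q - S (q + 1) := by linarith
    rw [h2]
    ring

/-- Lemma: properties of `v*` and `v_0`. -/
theorem stmt6 (r : ℕ) (hr : 1 ≤ r) :
    ∃ C : ℝ, 0 < C ∧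
      ∀ (n : ℕ), r + 1 ≤ n → ∀ θstar : Fin n → ℝ, (∃ t < n - r, DD r θstar t ≠ 0) →
        ∀ vstar : Fin n → ℝ, IsMinNormIn vstar (subdiff (fun α => Dl1 r α) θstar) →
        ∀ v0 : Fin n → ℝ,
          IsMinNormIn v0
            ((affineSpan ℝ (subdiff (fun α => Dl1 r α) θstar) : Set (Fin n → ℝ))) →
          ((r = 1 → v0 = vstar ∧
              ∀ (k : ℕ) (j : Fin k → ℕ) (sg : Fin k → ℝ), 1 ≤ k →
                IsKnotSeq 1 n θstar k j sg →
                sqnorm v0 = 1 / (nlen n 1 k j 0 : ℝ) + 1 / (nlen n 1 k j k : ℝ) +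
                  4 * ∑ i ∈ Finset.Ico 1 k,
                    (if sgext k sg i ≠ sgext k sg (i + 1) then 1 / (nlen n 1 k j i : ℝ)
                      else 0)) ∧
            (2 ≤ r →
              (Nat.factorial (r - 1) : ℝ) / (((r : ℝ) + 1) * 2 ^ (r - 1)) *
                  (n : ℝ) ^ (-(r : ℝ) + 1 / 2) ≤ eunorm v0) ∧
            (2 ≤ r → ∀ c : ℝ, 0 < c → c ≤ 1 →
              ∀ (k : ℕ) (j : Fin k → ℕ) (sg : Fin k → ℝ),
                IsKnotSeq r n θstar k j sg → MinLen n r k j sg c →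
                eunorm vstar ≤
                  C * c ^ (-(r : ℝ) + 1 / 2) * ((k : ℝ) + 1) ^ r *
                    (n : ℝ) ^ (-(r : ℝ) + 1 / 2))) := by
  refine ⟨(2 : ℝ) ^ r * (r : ℝ) ^ (2 * r), by positivity, ?_⟩
  intro n hn θ hθ vstar hvs v0 hv0
  refine ⟨?_, fun h2 => lower_bound r h2 n hn θ hθ v0 hv0.1, ?_⟩
  · rintro rfl
    have key : ∀ (k : ℕ) (j : Fin k → ℕ) (sg : Fin k → ℝ), IsKnotSeq 1 n θ k j sg →
        v0 = vstar ∧ sqnorm v0 = ∑ q ∈ Finset.range (k + 1),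
          (sgext k sg q - sgext k sg (q + 1)) ^ 2 / (nlen n 1 k j q : ℝ) := by
      intro k j sg hk
      obtain ⟨v, hv, hT⟩ := part_one n hn θ k j sg hk
      have hva := subset_affineSpan ℝ _ hv
      have h1 := eq_of_min v v0 _ (hT v hva) (hT v0 hv0.1) (hv0.2 v hva)
      have h2 := eq_of_min v vstar _ (hT v hva)
        (hT vstar (subset_affineSpan ℝ _ hvs.1)) (hvs.2 v hv)
      refine ⟨h1.trans h2.symm, ?_⟩
      rw [h1, ← hT v hva]
      exact Finset.sum_congr rfl fun i _ => by ring
    obtain ⟨k, j, sg, hk⟩ := exists_knotSeq 1 n θ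
    refine ⟨(key k j sg hk).1, ?_⟩
    intro k j sg hk1 hk
    rw [(key k j sg hk).2]
    exact final_sum n θ k hk1 j sg hk
  · intro h2 c hc _ k j sg hk hm
    exact upper_bound r h2 n hn θ vstar hvs c hc k j sg hk hm
end
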